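/- Suppose every type I 6-cycle in the D_4 Artin complex satisfies property (*) and every type II 6-cycle satisfies property (*). Then for all left cosets y_1, y_2, y_3 of A_ĉ and left cosets x_1, x_2, x_3, where x_i is a left coset of A_ŝ_i for some s_i ∈ {a,b,d}, such that y_i ∩ x_i ≠ ∅ and x_i ∩ y_{i+1} ≠ ∅ for i = 1,2,3 (indices mod 3), there exist t ∈ {a,b,d} and a left coset z of A_t̂ with z ∩ y_i ≠ ∅ for all i = 1,2,3. -/

import Mathlib

/-!
The Artin group of type `D₄`, with generators `a, b, c, d`, where `d` is the central node of
the Dynkin diagram: relations `ada = dad`, `bdb = dbd`, `cdc = dcd`, `ab = ba`, `ac = ca`,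
`bc = cb`.
-/

open Pointwise

namespace D4Artin

/-- The generators of the `D₄` Artin group. -/
inductive Gen : Type
  | a | b | c | d
deriving DecidableEq

open Gen

/-- The defining relators of the `D₄` Artin group: a braid relation `sts = tst` whenever one of
`s, t` is the central node `d`, and commutation `st = ts` otherwise. -/
def Rels : Set (FreeGroup Gen) :=
  { r | ∃ s t : Gen, s ≠ t ∧
      (((s = d ∨ t = d) ∧
          r = FreeGroup.of s * FreeGroup.of t * FreeGroup.of s *
              (FreeGroup.of t * FreeGroup.of s * FreeGroup.of t)⁻¹) ∨
        ((s ≠ d ∧ t ≠ d) ∧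
          r = FreeGroup.of s * FreeGroup.of t * (FreeGroup.of s)⁻¹ * (FreeGroup.of t)⁻¹)) }

/-- The Artin group of type `D₄`. -/
abbrev Artin : Type := PresentedGroup Rels

/-- The generators, as elements of the Artin group. -/
def gen (s : Gen) : Artin := PresentedGroup.of s

/-- The standard parabolic subgroup `A_ŝ` generated by the three generators other than `s`. -/
def Ahat (s : Gen) : Subgroup Artin :=
  Subgroup.closure { x | ∃ t : Gen, t ≠ s ∧ x = gen t }

/-- `X` is a left coset of the subgroup `H`. -/
def IsCosetOf (X : Set Artin) (H : Subgroup Artin) : Prop :=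
  ∃ g : Artin, X = g • (H : Set Artin)

/-- A type I 6-cycle: `x 0, x 2, x 4` are pairwise distinct left cosets of `A_â`,
`x 1, x 3, x 5` are pairwise distinct left cosets of `A_ĉ`, and consecutive cosets
(indices mod 6) have nonempty intersection. -/
def TypeI (x : Fin 6 → Set Artin) : Prop :=
  IsCosetOf (x 0) (Ahat a) ∧ IsCosetOf (x 2) (Ahat a) ∧ IsCosetOf (x 4) (Ahat a) ∧
  IsCosetOf (x 1) (Ahat c) ∧ IsCosetOf (x 3) (Ahat c) ∧ IsCosetOf (x 5) (Ahat c) ∧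
  x 0 ≠ x 2 ∧ x 0 ≠ x 4 ∧ x 2 ≠ x 4 ∧
  x 1 ≠ x 3 ∧ x 1 ≠ x 5 ∧ x 3 ≠ x 5 ∧
  ∀ i : Fin 6, (x i ∩ x (i + 1)).Nonempty

/-- A type II 6-cycle: `x 0, x 4` are distinct left cosets of `A_â`, `x 2` is a left coset of
`A_b̂`, `x 1, x 3, x 5` are pairwise distinct left cosets of `A_ĉ`, and consecutive cosets
(indices mod 6) have nonempty intersection. -/
def TypeII (x : Fin 6 → Set Artin) : Prop :=
  IsCosetOf (x 0) (Ahat a) ∧ IsCosetOf (x 4) (Ahat a) ∧ IsCosetOf (x 2) (Ahat b) ∧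
  IsCosetOf (x 1) (Ahat c) ∧ IsCosetOf (x 3) (Ahat c) ∧ IsCosetOf (x 5) (Ahat c) ∧
  x 0 ≠ x 4 ∧ x 1 ≠ x 3 ∧ x 1 ≠ x 5 ∧ x 3 ≠ x 5 ∧
  ∀ i : Fin 6, (x i ∩ x (i + 1)).Nonempty

/-- Property `(*)` for a 6-cycle: there is a left coset of `A_â` or of `A_b̂` meeting each of
`x 1`, `x 3`, `x 5`. -/
def Star (x : Fin 6 → Set Artin) : Prop :=
  ∃ z : Set Artin, (IsCosetOf z (Ahat a) ∨ IsCosetOf z (Ahat b)) ∧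
    (z ∩ x 1).Nonempty ∧ (z ∩ x 3).Nonempty ∧ (z ∩ x 5).Nonempty

end D4Artin

open D4Artin D4Artin.Gen

namespace D4Artin

/-- The vertex `g A_ŝ` is adjacent to the vertex `h A_ĉ` in the Artin complex. -/
def Meets (s : Gen) (g h : Artin) : Prop :=
  ((g • (Ahat s : Set Artin)) ∩ (h • (Ahat c : Set Artin))).Nonempty

theorem meets_iff {s : Gen} {g h : Artin} :
    Meets s g h ↔ ∃ u ∈ Ahat s, ∃ v ∈ Ahat c, g * u = h * v := by
  constructor
  · rintro ⟨x, ⟨u, hu, rfl⟩, ⟨v, hv, hx⟩⟩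
    exact ⟨u, hu, v, hv, hx.symm⟩
  · rintro ⟨u, hu, v, hv, hx⟩
    exact ⟨g * u, ⟨u, hu, rfl⟩, ⟨v, hv, hx.symm⟩⟩

theorem gen_mem_Ahat {s t : Gen} (h : t ≠ s) : gen t ∈ Ahat s :=
  Subgroup.subset_closure ⟨t, h, rfl⟩

theorem gen_braid {s t : Gen} (hst : s ≠ t) (hd : s = d ∨ t = d) :
    gen s * gen t * gen s = gen t * gen s * gen t := by
  have h : PresentedGroup.mk Rels (FreeGroup.of s * FreeGroup.of t * FreeGroup.of s *
      (FreeGroup.of t * FreeGroup.of s * FreeGroup.of t)⁻¹) = 1 :=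
    PresentedGroup.one_of_mem ⟨s, t, hst, Or.inl ⟨hd, rfl⟩⟩
  simp only [map_mul, map_inv] at h
  exact mul_inv_eq_one.mp h

theorem gen_commute {s t : Gen} (hst : s ≠ t) (hs : s ≠ d) (ht : t ≠ d) :
    Commute (gen s) (gen t) := by
  have h : PresentedGroup.mk Rels (FreeGroup.of s * FreeGroup.of t * (FreeGroup.of s)⁻¹ *
      (FreeGroup.of t)⁻¹) = 1 :=
    PresentedGroup.one_of_mem ⟨s, t, hst, Or.inr ⟨⟨hs, ht⟩, rfl⟩⟩
  simp only [map_mul, map_inv] at h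
  exact mul_inv_eq_iff_eq_mul.mp (mul_inv_eq_one.mp h)

theorem exists_eq_zpow_mul_of_mem_Ahat_d {u : Artin} (hu : u ∈ Ahat d) :
    ∃ n : ℤ, ∃ w ∈ Ahat c, u = gen c ^ n * w := by
  induction hu using Subgroup.closure_induction_left with
  | one => exact ⟨0, 1, one_mem _, by simp⟩
  | mul_left x hx y _ ih =>
    obtain ⟨t, ht, rfl⟩ := hx
    obtain ⟨n, w, hw, rfl⟩ := ih
    by_cases hc : t = c
    · subst hc
      exact ⟨1 + n, w, hw, by rw [zpow_one_add, mul_assoc]⟩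
    · refine ⟨n, gen t * w, mul_mem (gen_mem_Ahat hc) hw, ?_⟩
      rw [← mul_assoc, ← mul_assoc, ((gen_commute hc ht (by decide)).zpow_right n).eq]
  | inv_mul_cancel x hx y _ ih =>
    obtain ⟨t, ht, rfl⟩ := hx
    obtain ⟨n, w, hw, rfl⟩ := ih
    by_cases hc : t = c
    · subst hc
      exact ⟨-1 + n, w, hw, by rw [zpow_add, zpow_neg_one, mul_assoc]⟩
    · refine ⟨n, (gen t)⁻¹ * w, mul_mem (inv_mem (gen_mem_Ahat hc)) hw, ?_⟩
      rw [← mul_assoc, ← mul_assoc,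
        ((gen_commute hc ht (by decide)).inv_left.zpow_right n).eq]

theorem Meets.a_of_d {g h : Artin} (H : Meets d g h) : Meets a g h := by
  obtain ⟨u, hu, v, hv, e⟩ := meets_iff.mp H
  obtain ⟨n, w, hw, rfl⟩ := exists_eq_zpow_mul_of_mem_Ahat_d hu
  refine meets_iff.mpr ⟨gen c ^ n, zpow_mem (gen_mem_Ahat (by decide)) n, v * w⁻¹,
    mul_mem hv (inv_mem hw), ?_⟩
  rw [← mul_assoc h, ← e]
  group

/-- The diagram symmetry exchanging `a` and `b`. -/
def swapGen : Gen → Gen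
  | a => b
  | b => a
  | c => c
  | d => d

theorem swapGen_swapGen (s : Gen) : swapGen (swapGen s) = s := by cases s <;> rfl

theorem swapGen_ne {s t : Gen} (h : s ≠ t) : swapGen s ≠ swapGen t := fun e =>
  h (by rw [← swapGen_swapGen s, e, swapGen_swapGen])

/-- The endomorphism of the Artin group induced by the diagram symmetry exchanging `a`, `b`. -/
def swapHom : Artin →* Artin :=
  PresentedGroup.toGroup (f := fun s => gen (swapGen s)) (by
    rintro r ⟨s, t, hst, ⟨hd, rfl⟩ | ⟨⟨hs, ht⟩, rfl⟩⟩
    · simp only [map_mul, map_inv, FreeGroup.lift_apply_of]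
      exact mul_inv_eq_one.mpr (gen_braid (swapGen_ne hst)
        (hd.imp (fun h => by rw [h]; rfl) (fun h => by rw [h]; rfl)))
    · simp only [map_mul, map_inv, FreeGroup.lift_apply_of]
      exact mul_inv_eq_one.mpr (mul_inv_eq_iff_eq_mul.mpr
        (gen_commute (swapGen_ne hst) (swapGen_ne hs) (swapGen_ne ht)).eq))

theorem swapHom_gen (s : Gen) : swapHom (gen s) = gen (swapGen s) :=
  PresentedGroup.toGroup.of _

theorem swapHom_swapHom (g : Artin) : swapHom (swapHom g) = g := by
  have h : swapHom.comp swapHom = MonoidHom.id Artin := by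
    refine PresentedGroup.ext fun s => ?_
    change swapHom (swapHom (gen s)) = gen s
    rw [swapHom_gen, swapHom_gen, swapGen_swapGen]
  exact DFunLike.congr_fun h g

theorem swapHom_mem {s : Gen} {u : Artin} (hu : u ∈ Ahat s) :
    swapHom u ∈ Ahat (swapGen s) := by
  have h : Ahat s ≤ (Ahat (swapGen s)).comap swapHom := by
    refine (Subgroup.closure_le _).mpr ?_
    rintro _ ⟨t, ht, rfl⟩
    change swapHom (gen t) ∈ Ahat (swapGen s)
    rw [swapHom_gen]
    exact gen_mem_Ahat (swapGen_ne ht)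
  exact h hu

theorem Meets.swap {s : Gen} {g h : Artin} (H : Meets s g h) :
    Meets (swapGen s) (swapHom g) (swapHom h) := by
  obtain ⟨u, hu, v, hv, e⟩ := meets_iff.mp H
  have hv' : swapHom v ∈ Ahat c := swapHom_mem (s := c) hv
  have e' : swapHom g * swapHom u = swapHom h * swapHom v := by
    rw [← map_mul, ← map_mul, e]
  exact meets_iff.mpr ⟨swapHom u, swapHom_mem hu, swapHom v, hv', e'⟩

/-- Some vertex of type other than `ĉ` is adjacent to each of three given type `ĉ` vertices. -/
def HasQuasiCenter (y₀ y₁ y₂ : Artin) : Prop :=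
  ∃ (t : Gen) (z : Artin), t ≠ c ∧ Meets t z y₀ ∧ Meets t z y₁ ∧ Meets t z y₂

theorem HasQuasiCenter.rotate {y₀ y₁ y₂ : Artin} (H : HasQuasiCenter y₀ y₁ y₂) :
    HasQuasiCenter y₁ y₂ y₀ := by
  obtain ⟨t, z, ht, h₀, h₁, h₂⟩ := H
  exact ⟨t, z, ht, h₁, h₂, h₀⟩

theorem HasQuasiCenter.swap {y₀ y₁ y₂ : Artin} (H : HasQuasiCenter y₀ y₁ y₂) :
    HasQuasiCenter (swapHom y₀) (swapHom y₁) (swapHom y₂) := by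
  obtain ⟨t, z, ht, h₀, h₁, h₂⟩ := H
  exact ⟨swapGen t, swapHom z, swapGen_ne ht, h₀.swap, h₁.swap, h₂.swap⟩

/-- Every 6-cycle whose non-`ĉ` vertices have types `s₀, s₁, s₂` has a quasi-center. -/
def CyclesHaveQuasiCenter (s₀ s₁ s₂ : Gen) : Prop :=
  ∀ y₀ y₁ y₂ x₀ x₁ x₂ : Artin, Meets s₀ x₀ y₀ → Meets s₀ x₀ y₁ → Meets s₁ x₁ y₁ →
    Meets s₁ x₁ y₂ → Meets s₂ x₂ y₂ → Meets s₂ x₂ y₀ → HasQuasiCenter y₀ y₁ y₂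

theorem CyclesHaveQuasiCenter.rotate {s₀ s₁ s₂ : Gen} (H : CyclesHaveQuasiCenter s₀ s₁ s₂) :
    CyclesHaveQuasiCenter s₁ s₂ s₀ :=
  fun y₀ y₁ y₂ x₀ x₁ x₂ h₁ h₂ h₃ h₄ h₅ h₆ =>
    (H y₂ y₀ y₁ x₂ x₀ x₁ h₅ h₆ h₁ h₂ h₃ h₄).rotate

theorem CyclesHaveQuasiCenter.swap {s₀ s₁ s₂ : Gen} (H : CyclesHaveQuasiCenter s₀ s₁ s₂) :
    CyclesHaveQuasiCenter (swapGen s₀) (swapGen s₁) (swapGen s₂) := by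
  intro y₀ y₁ y₂ x₀ x₁ x₂ h₁ h₂ h₃ h₄ h₅ h₆
  have key := (H _ _ _ _ _ _ (swapGen_swapGen s₀ ▸ h₁.swap) (swapGen_swapGen s₀ ▸ h₂.swap)
    (swapGen_swapGen s₁ ▸ h₃.swap) (swapGen_swapGen s₁ ▸ h₄.swap)
    (swapGen_swapGen s₂ ▸ h₅.swap) (swapGen_swapGen s₂ ▸ h₆.swap)).swap
  simpa only [swapHom_swapHom] using key

theorem Meets.congr_left {s : Gen} {g g' h : Artin}
    (e : g • (Ahat s : Set Artin) = g' • (Ahat s : Set Artin)) (H : Meets s g h) :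
    Meets s g' h := by
  unfold Meets at *
  rwa [← e]

theorem Meets.congr_right {s : Gen} {g h h' : Artin}
    (e : h • (Ahat c : Set Artin) = h' • (Ahat c : Set Artin)) (H : Meets s g h) :
    Meets s g h' := by
  unfold Meets at *
  rwa [← e]

theorem hasQuasiCenter_of_star {x : Fin 6 → Set Artin} {y₀ y₁ y₂ : Artin} (H : Star x)
    (e₀ : x 1 = y₀ • (Ahat c : Set Artin)) (e₁ : x 3 = y₁ • (Ahat c : Set Artin))
    (e₂ : x 5 = y₂ • (Ahat c : Set Artin)) : HasQuasiCenter y₀ y₁ y₂ := by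
  obtain ⟨z, hz, h₀, h₁, h₂⟩ := H
  rw [e₀] at h₀
  rw [e₁] at h₁
  rw [e₂] at h₂
  obtain ⟨g, rfl⟩ | ⟨g, rfl⟩ := hz
  · exact ⟨a, g, by decide, h₀, h₁, h₂⟩
  · exact ⟨b, g, by decide, h₀, h₁, h₂⟩

theorem cyclesHaveQuasiCenter_of_distinct {s₀ s₁ s₂ : Gen} (hs₀ : s₀ ≠ c) (hs₁ : s₁ ≠ c)
    (hs₂ : s₂ ≠ c)
    (H : ∀ y₀ y₁ y₂ x₀ x₁ x₂ : Artin, Meets s₀ x₀ y₀ → Meets s₀ x₀ y₁ → Meets s₁ x₁ y₁ →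
      Meets s₁ x₁ y₂ → Meets s₂ x₂ y₂ → Meets s₂ x₂ y₀ →
      y₀ • (Ahat c : Set Artin) ≠ y₁ • (Ahat c : Set Artin) →
      y₀ • (Ahat c : Set Artin) ≠ y₂ • (Ahat c : Set Artin) →
      y₁ • (Ahat c : Set Artin) ≠ y₂ • (Ahat c : Set Artin) → HasQuasiCenter y₀ y₁ y₂) :
    CyclesHaveQuasiCenter s₀ s₁ s₂ := by
  intro y₀ y₁ y₂ x₀ x₁ x₂ h₁ h₂ h₃ h₄ h₅ h₆
  by_cases e₁ : y₀ • (Ahat c : Set Artin) = y₁ • (Ahat c : Set Artin)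
  · exact ⟨s₁, x₁, hs₁, h₃.congr_right e₁.symm, h₃, h₄⟩
  by_cases e₂ : y₀ • (Ahat c : Set Artin) = y₂ • (Ahat c : Set Artin)
  · exact ⟨s₀, x₀, hs₀, h₁, h₂, h₁.congr_right e₂⟩
  by_cases e₃ : y₁ • (Ahat c : Set Artin) = y₂ • (Ahat c : Set Artin)
  · exact ⟨s₂, x₂, hs₂, h₆, h₅.congr_right e₃.symm, h₅⟩
  exact H y₀ y₁ y₂ x₀ x₁ x₂ h₁ h₂ h₃ h₄ h₅ h₆ e₁ e₂ e₃

theorem cyclesHaveQuasiCenter_aaa (hI : ∀ x : Fin 6 → Set Artin, TypeI x → Star x) :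
    CyclesHaveQuasiCenter a a a := by
  refine cyclesHaveQuasiCenter_of_distinct (by decide) (by decide) (by decide) ?_
  intro y₀ y₁ y₂ x₀ x₁ x₂ h₁ h₂ h₃ h₄ h₅ h₆ e₁ e₂ e₃
  by_cases f₁ : x₂ • (Ahat a : Set Artin) = x₀ • (Ahat a : Set Artin)
  · exact ⟨a, x₀, by decide, h₁, h₂, h₅.congr_left f₁⟩
  by_cases f₂ : x₂ • (Ahat a : Set Artin) = x₁ • (Ahat a : Set Artin)
  · exact ⟨a, x₁, by decide, h₆.congr_left f₂, h₃, h₄⟩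
  by_cases f₃ : x₀ • (Ahat a : Set Artin) = x₁ • (Ahat a : Set Artin)
  · exact ⟨a, x₁, by decide, h₁.congr_left f₃, h₃, h₄⟩
  refine hasQuasiCenter_of_star (hI ![x₂ • (Ahat a : Set Artin), y₀ • (Ahat c : Set Artin),
    x₀ • (Ahat a : Set Artin), y₁ • (Ahat c : Set Artin), x₁ • (Ahat a : Set Artin),
    y₂ • (Ahat c : Set Artin)] ⟨⟨_, rfl⟩, ⟨_, rfl⟩, ⟨_, rfl⟩, ⟨_, rfl⟩, ⟨_, rfl⟩, ⟨_, rfl⟩,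
      f₁, f₂, f₃, e₁, e₂, e₃, ?_⟩) rfl rfl rfl
  intro i
  fin_cases i
  exacts [h₆, Set.inter_comm _ _ ▸ h₁, h₂, Set.inter_comm _ _ ▸ h₃, h₄,
    Set.inter_comm _ _ ▸ h₅]

theorem cyclesHaveQuasiCenter_baa (hII : ∀ x : Fin 6 → Set Artin, TypeII x → Star x) :
    CyclesHaveQuasiCenter b a a := by
  refine cyclesHaveQuasiCenter_of_distinct (by decide) (by decide) (by decide) ?_
  intro y₀ y₁ y₂ x₀ x₁ x₂ h₁ h₂ h₃ h₄ h₅ h₆ e₁ e₂ e₃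
  by_cases f : x₂ • (Ahat a : Set Artin) = x₁ • (Ahat a : Set Artin)
  · exact ⟨a, x₁, by decide, h₆.congr_left f, h₃, h₄⟩
  refine hasQuasiCenter_of_star (hII ![x₂ • (Ahat a : Set Artin), y₀ • (Ahat c : Set Artin),
    x₀ • (Ahat b : Set Artin), y₁ • (Ahat c : Set Artin), x₁ • (Ahat a : Set Artin),
    y₂ • (Ahat c : Set Artin)] ⟨⟨_, rfl⟩, ⟨_, rfl⟩, ⟨_, rfl⟩, ⟨_, rfl⟩, ⟨_, rfl⟩, ⟨_, rfl⟩,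
      f, e₁, e₂, e₃, ?_⟩) rfl rfl rfl
  intro i
  fin_cases i
  exacts [h₆, Set.inter_comm _ _ ▸ h₁, h₂, Set.inter_comm _ _ ▸ h₃, h₄,
    Set.inter_comm _ _ ▸ h₅]

theorem cyclesHaveQuasiCenter_of_ab (hI : ∀ x : Fin 6 → Set Artin, TypeI x → Star x)
    (hII : ∀ x : Fin 6 → Set Artin, TypeII x → Star x) {s₀ s₁ s₂ : Gen}
    (hs₀ : s₀ = a ∨ s₀ = b) (hs₁ : s₁ = a ∨ s₁ = b) (hs₂ : s₂ = a ∨ s₂ = b) :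
    CyclesHaveQuasiCenter s₀ s₁ s₂ := by
  have haaa := cyclesHaveQuasiCenter_aaa hI
  have hbaa := cyclesHaveQuasiCenter_baa hII
  rcases hs₀ with rfl | rfl <;> rcases hs₁ with rfl | rfl <;> rcases hs₂ with rfl | rfl
  exacts [haaa, hbaa.rotate, hbaa.rotate.rotate, hbaa.swap, hbaa,
    hbaa.rotate.rotate.swap, hbaa.rotate.swap, haaa.swap]

theorem exists_ab_of_ne_c {s : Gen} (hs : s ≠ c) :
    ∃ s', (s' = a ∨ s' = b) ∧ ∀ g h : Artin, Meets s g h → Meets s' g h := by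
  cases s with
  | a => exact ⟨a, Or.inl rfl, fun _ _ H => H⟩
  | b => exact ⟨b, Or.inr rfl, fun _ _ H => H⟩
  | c => exact absurd rfl hs
  | d => exact ⟨a, Or.inl rfl, fun _ _ H => H.a_of_d⟩

end D4Artin

/-- If every type I 6-cycle and every type II 6-cycle in the `D₄` Artin complex satisfies
property `(*)`, then every 6-cycle alternating between type `ĉ` vertices and non-type-`ĉ`
vertices has a quasi-center adjacent to each of its type `ĉ` vertices. -/
theorem quasiCenter_of_property_star
    (hI : ∀ x : Fin 6 → Set Artin, TypeI x → Star x)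
    (hII : ∀ x : Fin 6 → Set Artin, TypeII x → Star x)
    (gy gx : Fin 3 → Artin) (s : Fin 3 → Gen) (hs : ∀ i, s i ≠ c)
    (h1 : ∀ i : Fin 3,
      ((gy i • (Ahat c : Set Artin)) ∩ (gx i • (Ahat (s i) : Set Artin))).Nonempty)
    (h2 : ∀ i : Fin 3,
      ((gx i • (Ahat (s i) : Set Artin)) ∩ (gy (i + 1) • (Ahat c : Set Artin))).Nonempty) :
    ∃ (t : Gen) (z : Artin), t ≠ c ∧
      ∀ i : Fin 3, ((z • (Ahat t : Set Artin)) ∩ (gy i • (Ahat c : Set Artin))).Nonempty := by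
  choose s' hs' hm using fun i => exists_ab_of_ne_c (hs i)
  have h1' : ∀ i, Meets (s' i) (gx i) (gy i) := fun i => hm i _ _ (by
    rw [Meets, Set.inter_comm]
    exact h1 i)
  have h2' : ∀ i, Meets (s' i) (gx i) (gy (i + 1)) := fun i => hm i _ _ (h2 i)
  obtain ⟨t, z, ht, k₀, k₁, k₂⟩ := cyclesHaveQuasiCenter_of_ab hI hII (hs' 0) (hs' 1) (hs' 2)
    _ _ _ _ _ _ (h1' 0) (h2' 0) (h1' 1) (h2' 1) (h1' 2) (h2' 2)
  refine ⟨t, z, ht, fun i => ?_⟩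
  fin_cases i
  exacts [k₀, k₁, k₂]
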